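/- Let N ≥ 2 and let x_1, …, x_N be positive real numbers with ∑_{n=1}^N x_n = N. Set E = ∑_{n=1}^N |1 − x_n|. Then min_{1≤n≤N} x_n ≤ 1 − E/(2(N − 1)). -/

import Mathlib

/-- If `N ≥ 2` and `x_1, …, x_N > 0` with `∑ x_n = N`, then setting `E = ∑ |1 − x_n|`,
the smallest of the `x_n` satisfies `min_n x_n ≤ 1 − E/(2(N − 1))`. -/
theorem stmt14 (N : ℕ) (hN : 2 ≤ N) (x : Fin N → ℝ) (hx : ∀ n, 0 < x n)
    (hsum : ∑ n, x n = N) :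
    Finset.univ.inf'
        (Finset.univ_nonempty_iff.mpr (Fin.pos_iff_nonempty.mp (by omega))) x
      ≤ 1 - (∑ n, |1 - x n|) / (2 * ((N : ℝ) - 1)) := by
  have hN' : (2 : ℝ) ≤ N := by exact_mod_cast hN
  have hne : (Finset.univ : Finset (Fin N)).Nonempty :=
    Finset.univ_nonempty_iff.mpr (Fin.pos_iff_nonempty.mp (by omega))
  change Finset.univ.inf' hne x ≤ _
  set m := Finset.univ.inf' hne x
  have hm : ∀ n, m ≤ x n := fun n => Finset.inf'_le x (Finset.mem_univ n)
  have hm1 : m ≤ 1 := by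
    have h : ∑ _n : Fin N, m ≤ ∑ n, x n := Finset.sum_le_sum fun n _ => hm n
    simp only [Finset.sum_const, Finset.card_univ, Fintype.card_fin, nsmul_eq_mul, hsum] at h
    nlinarith
  obtain ⟨j, -, hj⟩ : ∃ j ∈ Finset.univ, 1 ≤ x j :=
    Finset.exists_le_of_sum_le hne (by simp [hsum])
  have hE : ∑ n, |1 - x n| ≤ ∑ n, ((x n - 1) + 2 * (1 - m) - if n = j then 2 * (1 - m) else 0) := by
    refine Finset.sum_le_sum fun n _ => ?_
    have hn := hm n
    split_ifs with h
    · subst h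
      rw [abs_le]
      constructor <;> linarith
    · rw [abs_le]
      constructor <;> linarith
  simp only [Finset.sum_sub_distrib, Finset.sum_add_distrib, Finset.sum_const, Finset.card_univ,
    Fintype.card_fin, nsmul_eq_mul, hsum, Finset.sum_ite_eq', Finset.mem_univ, if_true] at hE
  rw [le_sub_comm, div_le_iff₀ (by linarith)]
  linarith
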